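/- arXiv:1612.02503 — 2 statements merged into one kernel-verified Lean document; each statement's English description precedes it below -/
import Mathlib

section
/- Let A, B, X, Y, C be random variables on a common probability space, each taking finitely many values. Then 11·H[A,B,X,Y,C] ≤ 3H[X,Y] + 3H[A,X] + 3H[A,Y] + H[B,X] + H[B,Y] + 5H[C] + H[A,B,X,Y,C | A,B] + 4H[A,B,X,Y,C | A,X,Y] + H[A,B,X,Y,C | B,X,Y] + H[A,B,X,Y,C | A,C] + 2H[A,B,X,Y,C | X,C] + 2H[A,B,X,Y,C | Y,C]. -/
/-- Shannon entropy (base 2) of the random variable `f` on a finite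
probability space with mass function `p`. -/
noncomputable def entropy {Ω α : Type*} [Fintype Ω] (p : Ω → ℝ) (f : Ω → α) : ℝ :=
  letI := Classical.decEq α
  ∑ y ∈ Finset.univ.image f,
    -((∑ ω ∈ Finset.univ.filter (fun ω => f ω = y), p ω) *
        Real.logb 2 (∑ ω ∈ Finset.univ.filter (fun ω => f ω = y), p ω))

/-- Conditional entropy `H[f | g] := H[f, g] − H[g]`. -/
noncomputable def condEntropy {Ω α β : Type*} [Fintype Ω]
    (p : Ω → ℝ) (f : Ω → α) (g : Ω → β) : ℝ :=
  entropy p (fun ω => (f ω, g ω)) - entropy p g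

open Finset

section ShannonEntropy

open scoped Classical in
/-- The probability, under the mass function `p`, that `f` takes the same value as at `ω`. -/
noncomputable def fiberMass {Ω α : Type*} [Fintype Ω] (p : Ω → ℝ) (f : Ω → α) (ω : Ω) : ℝ :=
  ∑ ω', if f ω' = f ω then p ω' else 0

variable {Ω α β γ δ : Type*} [Fintype Ω] {p : Ω → ℝ}

theorem entropy_eq_sum_fiberMass (p : Ω → ℝ) (f : Ω → α) :
    entropy p f = -∑ ω, p ω * Real.logb 2 (fiberMass p f ω) := by
  classical
  rw [← Finset.sum_fiberwise_of_maps_to (s := univ) (t := univ.image f) (g := f)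
    (fun ω _ => mem_image_of_mem f (mem_univ ω)), ← Finset.sum_neg_distrib]
  unfold entropy
  refine Finset.sum_congr (by congr!) fun y _ => ?_
  rw [Finset.sum_mul]
  refine congrArg Neg.neg (Finset.sum_congr (by congr!) fun ω hω => ?_)
  have h : f ω = y := by simpa using hω
  subst h
  simp only [fiberMass, ← Finset.sum_filter]

theorem fiberMass_nonneg (hp : ∀ ω, 0 ≤ p ω) (f : Ω → α) (ω : Ω) : 0 ≤ fiberMass p f ω :=
  Finset.sum_nonneg fun ω' _ => by split_ifs <;> simp [hp]

theorem le_fiberMass (hp : ∀ ω, 0 ≤ p ω) (f : Ω → α) (ω : Ω) : p ω ≤ fiberMass p f ω := by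
  classical
  have h := Finset.single_le_sum (f := fun ω' => if f ω' = f ω then p ω' else 0)
    (fun ω' _ => by split_ifs <;> simp [hp]) (mem_univ ω)
  simpa [fiberMass] using h

theorem fiberMass_pos (hp : ∀ ω, 0 ≤ p ω) (f : Ω → α) {ω : Ω} (h : p ω ≠ 0) :
    0 < fiberMass p f ω :=
  ((hp ω).lt_of_ne' h).trans_le (le_fiberMass hp f ω)

/-- Entropy only depends on the partition that `f` induces on the support of `p`. -/
theorem entropy_congr {f : Ω → α} {g : Ω → β}
    (h : ∀ ω ω', p ω ≠ 0 → p ω' ≠ 0 → (f ω = f ω' ↔ g ω = g ω')) :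
    entropy p f = entropy p g := by
  classical
  simp only [entropy_eq_sum_fiberMass]
  refine congrArg Neg.neg (Finset.sum_congr rfl fun ω _ => ?_)
  by_cases h0 : p ω = 0
  · simp [h0]
  · have : fiberMass p f ω = fiberMass p g ω := by
      refine Finset.sum_congr rfl fun ω' _ => ?_
      by_cases h1 : p ω' = 0
      · simp [h1]
      · simp only [h ω' ω h1 h0]
    rw [this]

theorem entropy_const (hp1 : ∑ ω, p ω = 1) (a : α) : entropy p (fun _ => a) = 0 := by
  simp [entropy_eq_sum_fiberMass, fiberMass, hp1]

theorem fiberMass_congr {f : Ω → α} {ω ω' : Ω} (h : f ω = f ω') :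
    fiberMass p f ω = fiberMass p f ω' := by
  unfold fiberMass
  rw [h]

open scoped Classical in
theorem fiberMass_mul (f : Ω → α) (ω : Ω) (c : ℝ) :
    fiberMass p f ω * c = ∑ ω', if f ω' = f ω then p ω' * c else 0 := by
  simp only [fiberMass, Finset.sum_mul, ite_mul, zero_mul]

theorem sum_fiberMass_ratio_le (hp : ∀ ω, 0 ≤ p ω) {u : Ω → α} {v : Ω → β} {w : Ω → γ}
    {z : Ω → δ} (hu : ∀ ω ω', u ω = u ω' ↔ v ω = v ω' ∧ w ω = w ω')
    (hv : ∀ ω ω', v ω = v ω' → z ω = z ω') (hw : ∀ ω ω', w ω = w ω' → z ω = z ω') :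
    ∑ ω, p ω * (fiberMass p v ω * fiberMass p w ω / (fiberMass p u ω * fiberMass p z ω)) ≤
      ∑ ω, p ω := by
  classical
  have inner : ∀ a b : Ω, (∑ ω, if v a = v ω ∧ w b = w ω then
      p ω / (fiberMass p u ω * fiberMass p z ω) else 0) ≤
        if z b = z a then 1 / fiberMass p z a else 0 := by
    intro a b
    by_cases hex : ∃ ω, v a = v ω ∧ w b = w ω
    · obtain ⟨o, ho⟩ := hex
      have hza := hv _ _ ho.1
      rw [if_pos ((hw _ _ ho.2).trans hza.symm)]
      have : (∑ ω, if v a = v ω ∧ w b = w ω then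
          p ω / (fiberMass p u ω * fiberMass p z ω) else 0) =
          fiberMass p u o / fiberMass p u o * (1 / fiberMass p z a) := by
        rw [div_mul_div_comm, mul_one, div_eq_mul_inv, fiberMass_mul]
        refine Finset.sum_congr rfl fun ω _ => ?_
        have hiff : (v a = v ω ∧ w b = w ω) ↔ u ω = u o := by
          rw [hu, ho.1, ho.2, eq_comm, @eq_comm _ (w o)]
        by_cases hω : u ω = u o
        · rw [if_pos (hiff.2 hω), if_pos hω, fiberMass_congr hω,
            fiberMass_congr (hv _ _ (hiff.2 hω).1), div_eq_mul_inv]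
        · rw [if_neg (hiff.not.2 hω), if_neg hω]
      rw [this]
      exact mul_le_of_le_one_left (one_div_nonneg.2 (fiberMass_nonneg hp _ _)) (div_self_le_one _)
    · rw [Finset.sum_eq_zero fun ω _ => if_neg fun h => hex ⟨ω, h⟩]
      split_ifs
      · exact one_div_nonneg.2 (fiberMass_nonneg hp _ _)
      · rfl
  calc ∑ ω, p ω * (fiberMass p v ω * fiberMass p w ω / (fiberMass p u ω * fiberMass p z ω))
      = ∑ ω, ∑ a, ∑ b, p a * p b * (if v a = v ω ∧ w b = w ω then
          p ω / (fiberMass p u ω * fiberMass p z ω) else 0) := by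
        refine Finset.sum_congr rfl fun ω _ => ?_
        rw [mul_div_assoc', mul_div_right_comm, fiberMass.eq_def p v, fiberMass.eq_def p w,
          Finset.sum_mul_sum, Finset.mul_sum]
        refine Finset.sum_congr rfl fun a _ => ?_
        rw [Finset.mul_sum]
        refine Finset.sum_congr rfl fun b _ => ?_
        by_cases h1 : v a = v ω <;> by_cases h2 : w b = w ω <;> simp [h1, h2]
        ring
    _ = ∑ a, ∑ b, p a * p b * ∑ ω, (if v a = v ω ∧ w b = w ω then
          p ω / (fiberMass p u ω * fiberMass p z ω) else 0) := by
        rw [Finset.sum_comm]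
        refine Finset.sum_congr rfl fun a _ => ?_
        rw [Finset.sum_comm]
        simp only [Finset.mul_sum]
    _ ≤ ∑ a, ∑ b, p a * p b * (if z b = z a then 1 / fiberMass p z a else 0) := by
        gcongr with a _ b _
        · exact mul_nonneg (hp a) (hp b)
        · exact inner a b
    _ = ∑ a, p a * (fiberMass p z a / fiberMass p z a) := by
        refine Finset.sum_congr rfl fun a _ => ?_
        rw [div_eq_mul_one_div (fiberMass p z a), fiberMass_mul, Finset.mul_sum]
        refine Finset.sum_congr rfl fun b _ => ?_
        split_ifs <;> ring
    _ ≤ ∑ a, p a := by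
        gcongr with a _
        exact mul_le_of_le_one_right (hp a) (div_self_le_one _)

/-- Submodularity of entropy: if `u` generates the join of `v` and `w`, and `z` is a function of
`v` as well as of `w`, then `v` and `w` have nonnegative mutual information given `z`. -/
theorem entropy_submodular (hp : ∀ ω, 0 ≤ p ω) (u : Ω → α) (v : Ω → β) (w : Ω → γ)
    (z : Ω → δ) (hu : ∀ ω ω', u ω = u ω' ↔ v ω = v ω' ∧ w ω = w ω')
    (hv : ∀ ω ω', v ω = v ω' → z ω = z ω') (hw : ∀ ω ω', w ω = w ω' → z ω = z ω') :
    entropy p u + entropy p z ≤ entropy p v + entropy p w := by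
  have hlog : 0 < Real.log 2 := Real.log_pos one_lt_two
  have key : ∀ ω, p ω * (Real.logb 2 (fiberMass p v ω) + Real.logb 2 (fiberMass p w ω) -
      (Real.logb 2 (fiberMass p u ω) + Real.logb 2 (fiberMass p z ω))) ≤
      (p ω * (fiberMass p v ω * fiberMass p w ω / (fiberMass p u ω * fiberMass p z ω)) - p ω) /
        Real.log 2 := by
    intro ω
    by_cases h : p ω = 0
    · simp [h]
    have h1 := fiberMass_pos hp u h
    have h2 := fiberMass_pos hp v h
    have h3 := fiberMass_pos hp w h
    have h4 := fiberMass_pos hp z h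
    rw [← Real.logb_mul h2.ne' h3.ne', ← Real.logb_mul h1.ne' h4.ne',
      ← Real.logb_div (by positivity) (by positivity), Real.logb, ← mul_sub_one]
    rw [mul_div_assoc (p ω)]
    refine mul_le_mul_of_nonneg_left ?_ (hp ω)
    exact div_le_div_of_nonneg_right (Real.log_le_sub_one_of_pos (by positivity)) hlog.le
  have hsum := Finset.sum_le_sum fun ω (_ : ω ∈ univ) => key ω
  rw [← Finset.sum_div, Finset.sum_sub_distrib] at hsum
  have hneg := div_nonpos_of_nonpos_of_nonneg
    (sub_nonpos.2 (sum_fiberMass_ratio_le hp hu hv hw)) hlog.le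
  simp only [mul_sub, mul_add, Finset.sum_sub_distrib, Finset.sum_add_distrib] at hsum
  simp only [entropy_eq_sum_fiberMass]
  linarith

end ShannonEntropy

section ConditionalCopy

open scoped Classical in
/-- The mass function on `Ω × Ω` of two copies of the sample point that are conditionally
independent given the value of `k`. -/
noncomputable def copyMass {Ω κ : Type*} [Fintype Ω] (p : Ω → ℝ) (k : Ω → κ) (x : Ω × Ω) : ℝ :=
  if k x.2 = k x.1 then p x.1 * p x.2 / fiberMass p k x.1 else 0

variable {Ω κ α β : Type*} [Fintype Ω] {p : Ω → ℝ}

theorem copyMass_nonneg (hp : ∀ ω, 0 ≤ p ω) (k : Ω → κ) (x : Ω × Ω) : 0 ≤ copyMass p k x := by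
  unfold copyMass
  split_ifs
  · exact div_nonneg (mul_nonneg (hp _) (hp _)) (fiberMass_nonneg hp _ _)
  · rfl

theorem copyMass_swap (k : Ω → κ) (a b : Ω) : copyMass p k (a, b) = copyMass p k (b, a) := by
  by_cases h : k b = k a
  · simp [copyMass, h, fiberMass_congr h, mul_comm]
  · simp [copyMass, h, Ne.symm h]

theorem sum_copyMass_right (hp : ∀ ω, 0 ≤ p ω) (k : Ω → κ) (a : Ω) :
    ∑ b, copyMass p k (a, b) = p a := by
  classical
  have : ∑ b, copyMass p k (a, b) = p a * (fiberMass p k a / fiberMass p k a) := by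
    rw [div_eq_mul_one_div (fiberMass p k a), fiberMass_mul, Finset.mul_sum]
    refine Finset.sum_congr rfl fun b _ => ?_
    unfold copyMass
    split_ifs <;> ring
  rw [this]
  by_cases h : p a = 0
  · simp [h]
  · rw [div_self (fiberMass_pos hp k h).ne', mul_one]

theorem sum_copyMass_left (hp : ∀ ω, 0 ≤ p ω) (k : Ω → κ) (b : Ω) :
    ∑ a, copyMass p k (a, b) = p b := by
  simp only [copyMass_swap k _ b, sum_copyMass_right hp]

theorem sum_copyMass_mul_fst (hp : ∀ ω, 0 ≤ p ω) (k : Ω → κ) (F : Ω → ℝ) :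
    ∑ x : Ω × Ω, copyMass p k x * F x.1 = ∑ ω, p ω * F ω := by
  rw [Fintype.sum_prod_type]
  simp only [← Finset.sum_mul, sum_copyMass_right hp]

theorem sum_copyMass_mul_snd (hp : ∀ ω, 0 ≤ p ω) (k : Ω → κ) (F : Ω → ℝ) :
    ∑ x : Ω × Ω, copyMass p k x * F x.2 = ∑ ω, p ω * F ω := by
  rw [Fintype.sum_prod_type_right]
  simp only [← Finset.sum_mul, sum_copyMass_left hp]

theorem entropy_copyMass_fst (hp : ∀ ω, 0 ≤ p ω) (k : Ω → κ) (f : Ω → α) :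
    entropy (copyMass p k) (fun x => f x.1) = entropy p f := by
  classical
  have h : ∀ x : Ω × Ω, fiberMass (copyMass p k) (fun x => f x.1) x = fiberMass p f x.1 := by
    intro x
    have := sum_copyMass_mul_fst hp k fun ω => if f ω = f x.1 then 1 else 0
    simpa [fiberMass] using this
  simp only [entropy_eq_sum_fiberMass, h]
  rw [sum_copyMass_mul_fst hp k fun ω => Real.logb 2 (fiberMass p f ω)]

theorem entropy_copyMass_snd (hp : ∀ ω, 0 ≤ p ω) (k : Ω → κ) (f : Ω → α) :
    entropy (copyMass p k) (fun x => f x.2) = entropy p f := by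
  classical
  have h : ∀ x : Ω × Ω, fiberMass (copyMass p k) (fun x => f x.2) x = fiberMass p f x.2 := by
    intro x
    have := sum_copyMass_mul_snd hp k fun ω => if f ω = f x.2 then 1 else 0
    simpa [fiberMass] using this
  simp only [entropy_eq_sum_fiberMass, h]
  rw [sum_copyMass_mul_snd hp k fun ω => Real.logb 2 (fiberMass p f ω)]

/-- If `k` is a function of `v` and of `w`, the copies of `v` and `w` are conditionally independent
given `k`. -/
theorem entropy_copyMass_prod (hp : ∀ ω, 0 ≤ p ω) {k : Ω → κ} {v : Ω → α} {w : Ω → β}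
    (hv : ∀ ω ω', v ω = v ω' → k ω = k ω') (hw : ∀ ω ω', w ω = w ω' → k ω = k ω') :
    entropy (copyMass p k) (fun x => (v x.1, w x.2)) + entropy p k =
      entropy p v + entropy p w := by
  classical
  have hmass : ∀ x : Ω × Ω, k x.2 = k x.1 →
      fiberMass (copyMass p k) (fun x => (v x.1, w x.2)) x =
        fiberMass p v x.1 * fiberMass p w x.2 / fiberMass p k x.1 := by
    rintro ⟨a, b⟩ hab
    rw [fiberMass.eq_def p v, fiberMass.eq_def p w, Finset.sum_mul_sum, Finset.sum_div,
      fiberMass, Fintype.sum_prod_type]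
    refine Finset.sum_congr rfl fun a' _ => ?_
    rw [Finset.sum_div]
    refine Finset.sum_congr rfl fun b' _ => ?_
    by_cases h1 : v a' = v a
    · by_cases h2 : w b' = w b
      · have h3 := hv _ _ h1
        have h4 : k b' = k a' := (hw _ _ h2).trans (hab.trans h3.symm)
        simp [h1, h2, copyMass, h4, fiberMass_congr h3]
      · simp [h2]
    · simp [h1]
  have hpt : ∀ x : Ω × Ω, copyMass p k x *
      Real.logb 2 (fiberMass (copyMass p k) (fun x => (v x.1, w x.2)) x) =
      copyMass p k x * Real.logb 2 (fiberMass p v x.1) +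
      copyMass p k x * Real.logb 2 (fiberMass p w x.2) -
      copyMass p k x * Real.logb 2 (fiberMass p k x.1) := by
    intro x
    by_cases h0 : copyMass p k x = 0
    · simp [h0]
    have hk : k x.2 = k x.1 := by
      by_contra h
      exact h0 (by simp [copyMass, h])
    have h1 : p x.1 ≠ 0 := fun h => h0 (by simp [copyMass, h])
    have h2 : p x.2 ≠ 0 := fun h => h0 (by simp [copyMass, h])
    have hv1 := fiberMass_pos hp v h1
    have hw2 := fiberMass_pos hp w h2
    rw [hmass x hk, Real.logb_div (by positivity) (fiberMass_pos hp k h1).ne',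
      Real.logb_mul hv1.ne' hw2.ne']
    ring
  simp only [entropy_eq_sum_fiberMass, hpt, Finset.sum_sub_distrib, Finset.sum_add_distrib]
  rw [sum_copyMass_mul_fst hp k fun ω => Real.logb 2 (fiberMass p v ω),
    sum_copyMass_mul_snd hp k fun ω => Real.logb 2 (fiberMass p w ω),
    sum_copyMass_mul_fst hp k fun ω => Real.logb 2 (fiberMass p k ω)]
  ring

theorem entropy_copyMass_congr {k : Ω → κ} {f : Ω × Ω → α} {g : Ω × Ω → β}
    (h : ∀ x y : Ω × Ω, k x.2 = k x.1 → k y.2 = k y.1 → (f x = f y ↔ g x = g y)) :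
    entropy (copyMass p k) f = entropy (copyMass p k) g := by
  have hk : ∀ x : Ω × Ω, copyMass p k x ≠ 0 → k x.2 = k x.1 := fun x hx => by
    by_contra hne
    exact hx (by simp [copyMass, hne])
  exact entropy_congr fun x y hx hy => h x y (hk x hx) (hk y hy)

end ConditionalCopy

/-- The Zhang–Yeung inequality
`2 I(X;Y) ≤ I(A;B) + I(A;X,Y) + 3 I(X;Y|A) + I(X;Y|B)`, written in terms of joint entropies. -/
theorem zhang_yeung_inequality {Ω α β γ δ : Type*} [Fintype Ω] {p : Ω → ℝ} (hp : ∀ ω, 0 ≤ p ω)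
    (A : Ω → α) (B : Ω → β) (X : Ω → γ) (Y : Ω → δ) :
    2 * entropy p X + 2 * entropy p Y + entropy p A + entropy p (fun ω => (A ω, B ω)) +
      4 * entropy p (fun ω => (A ω, X ω, Y ω)) + entropy p (fun ω => (B ω, X ω, Y ω)) ≤
    3 * entropy p (fun ω => (X ω, Y ω)) + 3 * entropy p (fun ω => (A ω, X ω)) +
      3 * entropy p (fun ω => (A ω, Y ω)) + entropy p (fun ω => (B ω, X ω)) +
      entropy p (fun ω => (B ω, Y ω)) := by
  set k : Ω → γ × δ := fun ω => (X ω, Y ω) with hk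
  set q := copyMass p k with hq
  have hq0 : ∀ x, 0 ≤ q x := copyMass_nonneg hp k
  have fX : entropy q (fun x => X x.1) = _ := entropy_copyMass_fst hp k X
  have fY : entropy q (fun x => Y x.1) = _ := entropy_copyMass_fst hp k Y
  have fAB : entropy q (fun x => (A x.1, B x.1)) = _ :=
    entropy_copyMass_fst hp k fun ω => (A ω, B ω)
  have fAX : entropy q (fun x => (A x.1, X x.1)) = _ :=
    entropy_copyMass_fst hp k fun ω => (A ω, X ω)
  have fAY : entropy q (fun x => (A x.1, Y x.1)) = _ :=
    entropy_copyMass_fst hp k fun ω => (A ω, Y ω)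
  have fBX : entropy q (fun x => (B x.1, X x.1)) = _ :=
    entropy_copyMass_fst hp k fun ω => (B ω, X ω)
  have fBY : entropy q (fun x => (B x.1, Y x.1)) = _ :=
    entropy_copyMass_fst hp k fun ω => (B ω, Y ω)
  have fABXY : entropy q (fun x => (A x.1, B x.1, X x.1, Y x.1)) = _ :=
    entropy_copyMass_fst hp k fun ω => (A ω, B ω, X ω, Y ω)
  have cR : entropy q (fun x => A x.2) = _ := entropy_copyMass_snd hp k A
  have cRX : entropy q (fun x => (A x.2, X x.1)) = _ :=
    (entropy_copyMass_congr (by simp only [hk, Prod.mk.injEq]; grind)).trans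
      (entropy_copyMass_snd hp k fun ω => (A ω, X ω))
  have cRY : entropy q (fun x => (A x.2, Y x.1)) = _ :=
    (entropy_copyMass_congr (by simp only [hk, Prod.mk.injEq]; grind)).trans
      (entropy_copyMass_snd hp k fun ω => (A ω, Y ω))
  have mA : entropy q (fun x => (A x.2, A x.1, X x.1, Y x.1)) = entropy q _ :=
    entropy_copyMass_congr (g := fun x => ((A x.1, X x.1, Y x.1), (A x.2, X x.2, Y x.2)))
      (by simp only [hk, Prod.mk.injEq]; grind)
  have mB : entropy q (fun x => (A x.2, B x.1, X x.1, Y x.1)) = entropy q _ :=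
    entropy_copyMass_congr (g := fun x => ((B x.1, X x.1, Y x.1), (A x.2, X x.2, Y x.2)))
      (by simp only [hk, Prod.mk.injEq]; grind)
  have mAB : entropy q (fun x => (A x.2, A x.1, B x.1, X x.1, Y x.1)) = entropy q _ :=
    entropy_copyMass_congr (g := fun x => ((A x.1, B x.1, X x.1, Y x.1), (A x.2, X x.2, Y x.2)))
      (by simp only [hk, Prod.mk.injEq]; grind)
  have iA := entropy_copyMass_prod hp (k := k) (v := fun ω => (A ω, X ω, Y ω))
    (w := fun ω => (A ω, X ω, Y ω)) (by simp [hk]) (by simp [hk])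
  have iB := entropy_copyMass_prod hp (k := k) (v := fun ω => (B ω, X ω, Y ω))
    (w := fun ω => (A ω, X ω, Y ω)) (by simp [hk]) (by simp [hk])
  have iAB := entropy_copyMass_prod hp (k := k) (v := fun ω => (A ω, B ω, X ω, Y ω))
    (w := fun ω => (A ω, X ω, Y ω)) (by simp [hk]) (by simp [hk])
  have sRAgX := entropy_submodular hq0 (fun x => (A x.2, A x.1, X x.1)) (fun x => (A x.2, X x.1))
    (fun x => (A x.1, X x.1)) (fun x => X x.1) (by grind) (by grind) (by grind)
  have sRAgY := entropy_submodular hq0 (fun x => (A x.2, A x.1, Y x.1)) (fun x => (A x.2, Y x.1))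
    (fun x => (A x.1, Y x.1)) (fun x => Y x.1) (by grind) (by grind) (by grind)
  have sRBgX := entropy_submodular hq0 (fun x => (A x.2, B x.1, X x.1)) (fun x => (A x.2, X x.1))
    (fun x => (B x.1, X x.1)) (fun x => X x.1) (by grind) (by grind) (by grind)
  have sRBgY := entropy_submodular hq0 (fun x => (A x.2, B x.1, Y x.1)) (fun x => (A x.2, Y x.1))
    (fun x => (B x.1, Y x.1)) (fun x => Y x.1) (by grind) (by grind) (by grind)
  have sXYgRA := entropy_submodular hq0 (fun x => (A x.2, A x.1, X x.1, Y x.1))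
    (fun x => (A x.2, A x.1, X x.1)) (fun x => (A x.2, A x.1, Y x.1))
    (fun x => (A x.2, A x.1)) (by grind) (by grind) (by grind)
  have sXYgRB := entropy_submodular hq0 (fun x => (A x.2, B x.1, X x.1, Y x.1))
    (fun x => (A x.2, B x.1, X x.1)) (fun x => (A x.2, B x.1, Y x.1))
    (fun x => (A x.2, B x.1)) (by grind) (by grind) (by grind)
  have sABgR := entropy_submodular hq0 (fun x => (A x.2, A x.1, B x.1))
    (fun x => (A x.2, A x.1)) (fun x => (A x.2, B x.1)) (fun x => A x.2)
    (by grind) (by grind) (by grind)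
  have sRXYgAB := entropy_submodular hq0 (fun x => (A x.2, A x.1, B x.1, X x.1, Y x.1))
    (fun x => (A x.2, A x.1, B x.1)) (fun x => (A x.1, B x.1, X x.1, Y x.1))
    (fun x => (A x.1, B x.1)) (by grind) (by grind) (by grind)
  linarith

/-- Conditioning does not increase entropy. -/
theorem entropy_pair_le {Ω α β : Type*} [Fintype Ω] {p : Ω → ℝ} (hp : ∀ ω, 0 ≤ p ω)
    (hp1 : ∑ ω, p ω = 1) (f : Ω → α) (g : Ω → β) :
    entropy p (fun ω => (f ω, g ω)) ≤ entropy p f + entropy p g := by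
  have h := entropy_submodular hp (fun ω => (f ω, g ω)) f g (fun _ => ())
    (by simp) (by simp) (by simp)
  rwa [entropy_const hp1, add_zero] at h

/-- The conditional entropy of `f` given a function `g` of `f`. -/
theorem condEntropy_of_determined {Ω α β : Type*} [Fintype Ω] {p : Ω → ℝ} {f : Ω → α} {g : Ω → β}
    (h : ∀ ω ω', f ω = f ω' → g ω = g ω') :
    condEntropy p f g = entropy p f - entropy p g := by
  rw [condEntropy, entropy_congr (g := f)]
  grind

/-- The non-Shannon entropy inequality underlying Claim 1 for the
Zhang–Yeung query: for finitely-valued random variables `A, B, X, Y, C`,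
`11·H[ABXYC] ≤ 3H[XY] + 3H[AX] + 3H[AY] + H[BX] + H[BY] + 5H[C]
 + H[ABXYC|AB] + 4H[ABXYC|AXY] + H[ABXYC|BXY]
 + H[ABXYC|AC] + 2H[ABXYC|XC] + 2H[ABXYC|YC]`. -/
theorem zhang_yeung_claim1 {Ω α β γ δ ε : Type*} [Fintype Ω]
    [Fintype α] [Fintype β] [Fintype γ] [Fintype δ] [Fintype ε]
    (p : Ω → ℝ) (hp : ∀ ω, 0 ≤ p ω) (hp1 : ∑ ω, p ω = 1)
    (A : Ω → α) (B : Ω → β) (X : Ω → γ) (Y : Ω → δ) (C : Ω → ε) :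
    11 * entropy p (fun ω => (A ω, B ω, X ω, Y ω, C ω)) ≤
      3 * entropy p (fun ω => (X ω, Y ω)) +
      3 * entropy p (fun ω => (A ω, X ω)) +
      3 * entropy p (fun ω => (A ω, Y ω)) +
      entropy p (fun ω => (B ω, X ω)) +
      entropy p (fun ω => (B ω, Y ω)) +
      5 * entropy p C +
      condEntropy p (fun ω => (A ω, B ω, X ω, Y ω, C ω)) (fun ω => (A ω, B ω)) +
      4 * condEntropy p (fun ω => (A ω, B ω, X ω, Y ω, C ω)) (fun ω => (A ω, X ω, Y ω)) +
      condEntropy p (fun ω => (A ω, B ω, X ω, Y ω, C ω)) (fun ω => (B ω, X ω, Y ω)) +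
      condEntropy p (fun ω => (A ω, B ω, X ω, Y ω, C ω)) (fun ω => (A ω, C ω)) +
      2 * condEntropy p (fun ω => (A ω, B ω, X ω, Y ω, C ω)) (fun ω => (X ω, C ω)) +
      2 * condEntropy p (fun ω => (A ω, B ω, X ω, Y ω, C ω)) (fun ω => (Y ω, C ω)) := by
  have hAC := entropy_pair_le hp hp1 A C
  have hXC := entropy_pair_le hp hp1 X C
  have hYC := entropy_pair_le hp hp1 Y C
  have hZY := zhang_yeung_inequality hp A B X Y
  rw [condEntropy_of_determined (f := fun ω => (A ω, B ω, X ω, Y ω, C ω))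
      (g := fun ω => (A ω, B ω)) (by grind),
    condEntropy_of_determined (g := fun ω => (A ω, X ω, Y ω)) (by grind),
    condEntropy_of_determined (g := fun ω => (B ω, X ω, Y ω)) (by grind),
    condEntropy_of_determined (g := fun ω => (A ω, C ω)) (by grind),
    condEntropy_of_determined (g := fun ω => (X ω, C ω)) (by grind),
    condEntropy_of_determined (g := fun ω => (Y ω, C ω)) (by grind)]
  linarith
end

section
/- Let n be a positive integer and E a family of nonempty subsets of [n]. For each pair I, J ⊆ [n] with I ⊥ J (meaning I ⊄ J and J ⊄ I) let σ_{I,J} ∈ ℚ≥0, for each pair X ⊂ Y ⊆ [n] let μ_{X,Y} ∈ ℚ≥0, and for each Z ⊆ [n] let δ_Z ∈ ℚ≥0 with δ_Z = 0 whenever Z ∉ E. For ∅ ≠ Z ⊆ [n] define flow(Z) := δ_Z + Σ_{I⊥J, I∪J=Z} σ_{I,J} − Σ_{J : J⊥Z} σ_{Z,J} − Σ_{X⊂Z} μ_{X,Z} + Σ_{Y⊃Z} μ_{Z,Y} (so each σ_{I,J} contributes +σ_{I,J} to flow(I∪J) and −σ_{I,J} to flow(I) and to flow(J), and each μ_{X,Y}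 contributes +μ_{X,Y} to flow(X) and −μ_{X,Y} to flow(Y)). Assume flow(Z) ≥ 0 for every nonempty Z ⊆ [n] and flow([n]) ≥ 1, and let D be a positive integer that is a common denominator of all the entries δ, σ, μ. Then there exist D integral edge covers λ⁽¹⁾,…,λ⁽ᴰ⁾ : E → ℕ of the hypergraph ([n], E) such that Σ_{i=1}^{D} λ⁽ⁱ⁾_F ≤ D·δ_F for every F ∈ E. -/
open Finset

/-- Summing over the related pairs with first entry `z`. -/
theorem sum_filter_mul_fst_eq {α R : Type*} [Fintype α] [DecidableEq α] [NonAssocSemiring R]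
    (r : α → α → Prop) [DecidableRel r] (f : α → α → R) (z : α) :
    ∑ p : α × α with r p.1 p.2, f p.1 p.2 * (if p.1 = z then 1 else 0)
      = ∑ y with r z y, f z y := by
  simp only [Finset.sum_filter, Fintype.sum_prod_type]
  rw [Finset.sum_eq_single z (fun x _ hx => by simp [hx]) (by simp)]
  simp

/-- Summing over the related pairs with second entry `z`. -/
theorem sum_filter_mul_snd_eq {α R : Type*} [Fintype α] [DecidableEq α] [NonAssocSemiring R]
    (r : α → α → Prop) [DecidableRel r] (f : α → α → R) (z : α) :
    ∑ p : α × α with r p.1 p.2, f p.1 p.2 * (if p.2 = z then 1 else 0)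
      = ∑ x with r x z, f x z := by
  simp only [Finset.sum_filter, Fintype.sum_prod_type]
  refine Finset.sum_congr rfl fun x _ => ?_
  rw [Finset.sum_eq_single z (fun y _ hy => by simp [hy]) (by simp)]
  simp

/-- A derivation step `a` replaces the sets counted by `parts a` by the set `target a`, and it is
used `m a` times. If the steps turn the supply `d` into at least the total of the covers `lam`,
then undoing them one at a time yields covers whose total is at most `d`. -/
theorem exists_covers_le_supply {V ι κ : Type*} [DecidableEq V] [Fintype κ] [DecidableEq κ]
    [DecidableEq ι] (T : Finset ι) (target : ι → Finset V) (parts : ι → Finset V → ℕ)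
    (hparts : ∀ a ∈ T, ∀ v ∈ target a, ∃ F, v ∈ F ∧ 0 < parts a F)
    (d : Finset V → ℕ) (m : ι → ℕ) (lam : κ → Finset V → ℕ)
    (hcover : ∀ k v, ∃ F, v ∈ F ∧ 0 < lam k F)
    (hbalance : ∀ Z : Finset V, Z.Nonempty →
      ∑ k, lam k Z + ∑ a ∈ T, m a * parts a Z
        ≤ d Z + ∑ a ∈ T, m a * (Pi.single (target a) 1 : Finset V → ℕ) Z) :
    ∃ lam' : κ → Finset V → ℕ, (∀ k v, ∃ F, v ∈ F ∧ 0 < lam' k F) ∧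
      ∀ Z : Finset V, Z.Nonempty → ∑ k, lam' k Z ≤ d Z := by
  induction hN : ∑ a ∈ T, m a generalizing m lam with
  | zero =>
    refine ⟨lam, hcover, fun Z hZ => ?_⟩
    have hm : ∀ a ∈ T, m a = 0 := by simpa using hN
    have h := hbalance Z hZ
    have hzero (f : ι → ℕ) : ∑ a ∈ T, m a * f a = 0 :=
      Finset.sum_eq_zero fun a ha => by simp [hm a ha]
    simpa only [hzero, add_zero] using h
  | succ N ih =>
    by_cases hdone : ∀ Z : Finset V, Z.Nonempty → ∑ k, lam k Z ≤ d Z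
    · exact ⟨lam, hcover, hdone⟩
    push Not at hdone
    obtain ⟨Z, hZ, hlt⟩ := hdone
    obtain ⟨a, ha, hma⟩ : ∃ a ∈ T, m a * (Pi.single (target a) 1 : Finset V → ℕ) Z ≠ 0 := by
      apply Finset.exists_ne_zero_of_sum_ne_zero
      have := hbalance Z hZ
      omega
    obtain ⟨k, -, hk⟩ : ∃ k ∈ Finset.univ, lam k Z ≠ 0 := by
      apply Finset.exists_ne_zero_of_sum_ne_zero
      omega
    have htarget : target a = Z := by
      by_contra h
      simp [Pi.single_eq_of_ne' h] at hma
    have hm : m a ≠ 0 := fun h => hma (by simp [h])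
    obtain ⟨m', rfl⟩ : ∃ m' : ι → ℕ, m = m' + Pi.single a 1 := by
      refine ⟨m - Pi.single a 1, (tsub_add_cancel_of_le fun b => ?_).symm⟩
      by_cases h : b = a
      · subst h
        simpa [Nat.one_le_iff_ne_zero] using hm
      · simp [h]
    obtain ⟨l, hl⟩ : ∃ l : Finset V → ℕ, lam k = l + Pi.single Z 1 := by
      refine ⟨lam k - Pi.single Z 1, (tsub_add_cancel_of_le fun F => ?_).symm⟩
      by_cases h : F = Z
      · subst h
        simpa [Nat.one_le_iff_ne_zero] using hk
      · simp [h]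
    have hsingle (f : ι → ℕ) : ∑ b ∈ T, (Pi.single a 1 : ι → ℕ) b * f b = f a := by
      simp [Pi.single_apply, ha]
    refine ih m' (Function.update lam k (l + parts a)) ?_ ?_ ?_
    · intro k' v
      by_cases hkk : k' = k
      · subst hkk
        obtain ⟨F, hvF, hF⟩ := hcover k' v
        by_cases hFZ : F = Z
        · subst hFZ
          obtain ⟨G, hvG, hG⟩ := hparts a ha v (htarget ▸ hvF)
          exact ⟨G, hvG, by simp [hG]⟩
        · refine ⟨F, hvF, ?_⟩
          rw [hl] at hF
          simp only [Pi.add_apply, Pi.single_eq_of_ne hFZ] at hF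
          simp only [Function.update_self, Pi.add_apply]
          omega
      · simpa [hkk] using hcover k' v
    · intro W hW
      have h := hbalance W hW
      simp only [Pi.add_apply, add_mul, Finset.sum_add_distrib, hsingle, htarget] at h
      have hrest : ∑ x ∈ Finset.univ.erase k, Function.update lam k (l + parts a) x W
          = ∑ x ∈ Finset.univ.erase k, lam x W :=
        Finset.sum_congr rfl fun x hx => by simp [Finset.ne_of_mem_erase hx]
      rw [← Finset.add_sum_erase _ _ (Finset.mem_univ k), hl] at h
      rw [← Finset.add_sum_erase _ _ (Finset.mem_univ k), hrest]
      simp only [Function.update_self, Pi.add_apply, Pi.single_apply] at h ⊢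
      omega
    · simp only [Pi.add_apply, Finset.sum_add_distrib] at hN
      have := hsingle fun _ => 1
      simp only [mul_one] at this
      omega

/-- **Claim 2 in the proof of the integral edge cover bound.**
Given nonnegative rational dual variables `σ` (on incomparable pairs),
`μ` (on proper-subset pairs), and `δ` (supported on the edges `E`), define
`flow(Z) = δ_Z + Σ_{I⊥J, I∪J=Z} σ_{I,J} − Σ_{J⊥Z} (σ_{Z,J} + σ_{J,Z})
 − Σ_{X⊂Z} μ_{X,Z} + Σ_{Y⊃Z} μ_{Z,Y}` (each `σ_{I,J}` contributes
`+σ_{I,J}` to `flow(I∪J)` and `−σ_{I,J}` to both `flow(I)` and `flow(J)`).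
If `flow(Z) ≥ 0` for every nonempty `Z`, `flow([n]) ≥ 1`, and `D` is a common
denominator of all the entries, then there are `D` integral edge covers
`λ⁽¹⁾,…,λ⁽ᴰ⁾` with `Σ_i λ⁽ⁱ⁾_F ≤ D·δ_F` for every edge `F ∈ E`. -/
theorem integral_edge_covers_from_dual {n : ℕ} (hn : 0 < n)
    (E : Finset (Finset (Fin n))) (hE : ∀ F ∈ E, F.Nonempty)
    (σ : Finset (Fin n) → Finset (Fin n) → ℚ)
    (μ : Finset (Fin n) → Finset (Fin n) → ℚ)
    (δ : Finset (Fin n) → ℚ)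
    (hσ : ∀ I J, 0 ≤ σ I J) (hμ : ∀ X Y, 0 ≤ μ X Y) (hδ : ∀ Z, 0 ≤ δ Z)
    (hδE : ∀ Z, Z ∉ E → δ Z = 0)
    (flow : Finset (Fin n) → ℚ)
    (hflow : ∀ Z : Finset (Fin n), flow Z =
      δ Z
      + ∑ p ∈ (Finset.univ ×ˢ Finset.univ).filter
            (fun p : Finset (Fin n) × Finset (Fin n) =>
              (¬ p.1 ⊆ p.2 ∧ ¬ p.2 ⊆ p.1) ∧ p.1 ∪ p.2 = Z),
          σ p.1 p.2
      - ∑ J ∈ Finset.univ.filter (fun J : Finset (Fin n) => ¬ Z ⊆ J ∧ ¬ J ⊆ Z),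
          (σ Z J + σ J Z)
      - ∑ X ∈ Finset.univ.filter (fun X : Finset (Fin n) => X ⊂ Z), μ X Z
      + ∑ Y ∈ Finset.univ.filter (fun Y : Finset (Fin n) => Z ⊂ Y), μ Z Y)
    (hflow_nonneg : ∀ Z : Finset (Fin n), Z.Nonempty → 0 ≤ flow Z)
    (hflow_univ : 1 ≤ flow Finset.univ)
    (D : ℕ) (hD : 0 < D)
    (hDδ : ∀ Z, ∃ m : ℕ, (D : ℚ) * δ Z = m)
    (hDσ : ∀ I J, ∃ m : ℕ, (D : ℚ) * σ I J = m)
    (hDμ : ∀ X Y, ∃ m : ℕ, (D : ℚ) * μ X Y = m) :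
    ∃ lam : Fin D → Finset (Fin n) → ℕ,
      (∀ i : Fin D, ∀ v : Fin n,
        1 ≤ ∑ F ∈ E.filter (fun F => v ∈ F), lam i F) ∧
      (∀ F ∈ E, ((∑ i : Fin D, lam i F : ℕ) : ℚ) ≤ (D : ℚ) * δ F) := by
  choose d hd using hDδ
  choose s hs using hDσ
  choose m hm using hDμ
  let A : Finset (Finset (Fin n) × Finset (Fin n)) :=
    Finset.univ.filter fun p => ¬ p.1 ⊆ p.2 ∧ ¬ p.2 ⊆ p.1
  let B : Finset (Finset (Fin n) × Finset (Fin n)) := Finset.univ.filter fun p => p.1 ⊂ p.2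
  have hunion (Z : Finset (Fin n)) :
      ∑ p ∈ (Finset.univ ×ˢ Finset.univ).filter
            (fun p : Finset (Fin n) × Finset (Fin n) =>
              (¬ p.1 ⊆ p.2 ∧ ¬ p.2 ⊆ p.1) ∧ p.1 ∪ p.2 = Z), σ p.1 p.2
        = ∑ p ∈ A, σ p.1 p.2 * (if p.1 ∪ p.2 = Z then 1 else 0) := by
    simp only [A, mul_ite, mul_one, mul_zero, ← Finset.sum_filter, Finset.filter_filter,
      Finset.univ_product_univ]
  have hpair (Z : Finset (Fin n)) :
      ∑ J ∈ Finset.univ.filter (fun J : Finset (Fin n) => ¬ Z ⊆ J ∧ ¬ J ⊆ Z), (σ Z J + σ J Z)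
        = ∑ p ∈ A, σ p.1 p.2 * ((if p.1 = Z then 1 else 0) + (if p.2 = Z then 1 else 0)) := by
    simp only [A, mul_add, Finset.sum_add_distrib]
    rw [sum_filter_mul_fst_eq (fun I J => ¬ I ⊆ J ∧ ¬ J ⊆ I) σ Z,
      sum_filter_mul_snd_eq (fun I J => ¬ I ⊆ J ∧ ¬ J ⊆ I) σ Z]
    simp only [and_comm]
  have hbelow (Z : Finset (Fin n)) :
      ∑ X ∈ Finset.univ.filter (fun X : Finset (Fin n) => X ⊂ Z), μ X Z
        = ∑ p ∈ B, μ p.1 p.2 * (if p.2 = Z then 1 else 0) :=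
    (sum_filter_mul_snd_eq (fun X Y => X ⊂ Y) μ Z).symm
  have habove (Z : Finset (Fin n)) :
      ∑ Y ∈ Finset.univ.filter (fun Y : Finset (Fin n) => Z ⊂ Y), μ Z Y
        = ∑ p ∈ B, μ p.1 p.2 * (if p.1 = Z then 1 else 0) :=
    (sum_filter_mul_fst_eq (fun X Y => X ⊂ Y) μ Z).symm
  obtain ⟨lam, hcover, hle⟩ := exists_covers_le_supply (κ := Fin D) (A.disjSum B)
    (Sum.elim (fun p => p.1 ∪ p.2) Prod.fst)
    (Sum.elim (fun p => Pi.single p.1 1 + Pi.single p.2 1) (fun p => Pi.single p.2 1))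
    (by
      rintro (p | p) hp v hv
      · rcases Finset.mem_union.1 hv with hv | hv
        · exact ⟨p.1, hv, by simp⟩
        · exact ⟨p.2, hv, by simp⟩
      · have hp : p.1 ⊂ p.2 := by simpa [B] using hp
        exact ⟨p.2, hp.1 hv, by simp⟩)
    d (Sum.elim (fun p => s p.1 p.2) (fun p => m p.1 p.2))
    (fun _ => Pi.single Finset.univ 1)
    (fun _ v => ⟨Finset.univ, by simp⟩)
    (by
      intro Z hZ
      have hdemand : (D : ℚ) * (if Z = Finset.univ then 1 else 0) ≤ D * flow Z := by
        refine mul_le_mul_of_nonneg_left ?_ (Nat.cast_nonneg D)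
        split_ifs with h
        · exact h ▸ hflow_univ
        · exact hflow_nonneg Z hZ
      rw [hflow, hunion, hpair, hbelow, habove] at hdemand
      simp only [mul_add, mul_sub, Finset.mul_sum, ← mul_assoc, hd, hs, hm] at hdemand
      simp only [Finset.sum_disjSum, Sum.elim_inl, Sum.elim_inr, Finset.sum_const,
        Finset.card_univ, Fintype.card_fin, smul_eq_mul, mul_add, Pi.add_apply]
      simp only [Pi.single_apply, eq_comm (a := Z)] at hdemand ⊢
      rw [← Nat.cast_le (α := ℚ)]
      push_cast
      linarith)
  refine ⟨lam, fun i v => ?_, fun F hF => ?_⟩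
  · obtain ⟨F, hvF, hF⟩ := hcover i v
    have hFE : F ∈ E := by
      by_contra h
      have hdF : d F = 0 := by
        have := hd F
        rw [hδE F h, mul_zero] at this
        exact_mod_cast this.symm
      have h1 : lam i F ≤ ∑ k, lam k F :=
        Finset.single_le_sum (f := fun k => lam k F) (fun _ _ => Nat.zero_le _) (Finset.mem_univ i)
      have := hle F ⟨v, hvF⟩
      omega
    exact hF.trans_le (Finset.single_le_sum (f := lam i) (fun _ _ => Nat.zero_le _)
      (Finset.mem_filter.2 ⟨hFE, hvF⟩))
  · rw [hd]
    exact_mod_cast hle F (hE F hF)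
end
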